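/- (Second μ-derivative bound, inequalities (5.15)–(5.16), orthant case.) Fix x ∈ ℝ^n, λ ∈ ℝ^m, ρ > 0. The function μ ↦ ρ·φ(s(x,λ;μ,ρ)) (which equals ∂η/∂μ) is differentiable on (0,∞) with derivative −ρ²·∑_{i=1}^n 1/(s_i·(s_i+z_i)), where s := s(x,λ;μ,ρ), z := z(x,λ;μ,ρ); moreover this derivative satisfies −ρn/μ ≤ −ρ²·∑_{i=1}^n 1/(s_i·(s_i+z_i)) < 0 for every μ > 0 (i.e., 0 < −η''_{μμ}(x,λ;μ,ρ) ≤ ρν/μ). -/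

import Mathlib

open scoped BigOperators

noncomputable def svec {m n : ℕ} (A : Matrix (Fin m) (Fin n) ℝ) (c x : Fin n → ℝ)
    (lam : Fin m → ℝ) (μ ρ : ℝ) : Fin n → ℝ := fun i =>
  (Real.sqrt ((ρ * x i - c i + A.transpose.mulVec lam i) ^ 2 + 4 * ρ * μ)
    - (ρ * x i - c i + A.transpose.mulVec lam i)) / 2

noncomputable def zvec {m n : ℕ} (A : Matrix (Fin m) (Fin n) ℝ) (c x : Fin n → ℝ)
    (lam : Fin m → ℝ) (μ ρ : ℝ) : Fin n → ℝ := fun i =>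
  (Real.sqrt ((ρ * x i - c i + A.transpose.mulVec lam i) ^ 2 + 4 * ρ * μ)
    + (ρ * x i - c i + A.transpose.mulVec lam i)) / 2

noncomputable def phi {n : ℕ} (y : Fin n → ℝ) : ℝ := -∑ i, Real.log (y i)

noncomputable def Lag {m n : ℕ} (A : Matrix (Fin m) (Fin n) ℝ) (b : Fin m → ℝ)
    (c x : Fin n → ℝ) (lam : Fin m → ℝ) (s : Fin n → ℝ) (μ ρ : ℝ) : ℝ :=
  -(ρ * ∑ j, b j * lam j) + ρ * μ * phi s
    + ρ * ∑ i, x i * (A.transpose.mulVec lam i + s i - c i)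
    + (1 / 2) * ∑ i, (A.transpose.mulVec lam i + s i - c i) ^ 2

noncomputable def eta {m n : ℕ} (A : Matrix (Fin m) (Fin n) ℝ) (b : Fin m → ℝ)
    (c x : Fin n → ℝ) (lam : Fin m → ℝ) (μ ρ : ℝ) : ℝ :=
  Lag A b c x lam (svec A c x lam μ ρ) μ ρ

lemma abs_lt_sqrt_sq_add {u t : ℝ} (ht : 0 < t) : |u| < Real.sqrt (u ^ 2 + t) := by
  rw [← Real.sqrt_sq_eq_abs]
  exact Real.sqrt_lt_sqrt (sq_nonneg u) (by linarith)

lemma svec_pos {m n : ℕ} (A : Matrix (Fin m) (Fin n) ℝ) (c x : Fin n → ℝ)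
    (lam : Fin m → ℝ) {μ ρ : ℝ} (hμ : 0 < μ) (hρ : 0 < ρ) (i : Fin n) :
    0 < svec A c x lam μ ρ i := by
  have h := (le_abs_self _).trans_lt (abs_lt_sqrt_sq_add
    (u := ρ * x i - c i + A.transpose.mulVec lam i) (t := 4 * ρ * μ) (by positivity))
  unfold svec
  linarith

lemma zvec_pos {m n : ℕ} (A : Matrix (Fin m) (Fin n) ℝ) (c x : Fin n → ℝ)
    (lam : Fin m → ℝ) {μ ρ : ℝ} (hμ : 0 < μ) (hρ : 0 < ρ) (i : Fin n) :
    0 < zvec A c x lam μ ρ i := by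
  have h := (neg_le_abs _).trans_lt (abs_lt_sqrt_sq_add
    (u := ρ * x i - c i + A.transpose.mulVec lam i) (t := 4 * ρ * μ) (by positivity))
  unfold zvec
  linarith

lemma svec_add_zvec {m n : ℕ} (A : Matrix (Fin m) (Fin n) ℝ) (c x : Fin n → ℝ)
    (lam : Fin m → ℝ) (μ ρ : ℝ) (i : Fin n) :
    svec A c x lam μ ρ i + zvec A c x lam μ ρ i =
      Real.sqrt ((ρ * x i - c i + A.transpose.mulVec lam i) ^ 2 + 4 * ρ * μ) := by
  unfold svec zvec
  ring

lemma svec_mul_zvec {m n : ℕ} (A : Matrix (Fin m) (Fin n) ℝ) (c x : Fin n → ℝ)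
    (lam : Fin m → ℝ) {μ ρ : ℝ} (hμ : 0 < μ) (hρ : 0 < ρ) (i : Fin n) :
    svec A c x lam μ ρ i * zvec A c x lam μ ρ i = ρ * μ := by
  have h := Real.sq_sqrt (x := (ρ * x i - c i + A.transpose.mulVec lam i) ^ 2 + 4 * ρ * μ)
    (by positivity)
  unfold svec zvec
  linear_combination h / 4

lemma hasDerivAt_svec {m n : ℕ} (A : Matrix (Fin m) (Fin n) ℝ) (c x : Fin n → ℝ)
    (lam : Fin m → ℝ) {μ ρ : ℝ} (hμ : 0 < μ) (hρ : 0 < ρ) (i : Fin n) :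
    HasDerivAt (fun μ' => svec A c x lam μ' ρ i)
      (ρ / (svec A c x lam μ ρ i + zvec A c x lam μ ρ i)) μ := by
  rw [svec_add_zvec]
  unfold svec
  have hlin := ((hasDerivAt_id' μ).const_mul (4 * ρ)).const_add
    ((ρ * x i - c i + A.transpose.mulVec lam i) ^ 2)
  have hne : (ρ * x i - c i + A.transpose.mulVec lam i) ^ 2 + 4 * ρ * μ ≠ 0 := by positivity
  refine (((hlin.sqrt hne).sub_const
    (ρ * x i - c i + A.transpose.mulVec lam i)).div_const 2).congr_deriv ?_
  ring

/-- inequalities (5.15)–(5.16), orthant case: `μ ↦ ρφ(s(x,λ;μ,ρ))`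
is differentiable with derivative `-ρ² ∑ 1/(sᵢ(sᵢ+zᵢ))`, and this derivative lies in
`[-ρn/μ, 0)`. -/
theorem stmt17 {m n : ℕ} (hn : 0 < n) (A : Matrix (Fin m) (Fin n) ℝ) (c : Fin n → ℝ)
    (x : Fin n → ℝ) (lam : Fin m → ℝ) (ρ : ℝ) (hρ : 0 < ρ) :
    ∀ μ : ℝ, 0 < μ →
      HasDerivAt (fun μ' : ℝ => ρ * phi (svec A c x lam μ' ρ))
        (-(ρ ^ 2) * ∑ i, 1 / (svec A c x lam μ ρ i *
          (svec A c x lam μ ρ i + zvec A c x lam μ ρ i))) μ ∧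
      -(ρ * n) / μ ≤ -(ρ ^ 2) * ∑ i, 1 / (svec A c x lam μ ρ i *
          (svec A c x lam μ ρ i + zvec A c x lam μ ρ i)) ∧
      -(ρ ^ 2) * ∑ i, 1 / (svec A c x lam μ ρ i *
          (svec A c x lam μ ρ i + zvec A c x lam μ ρ i)) < 0 := by
  intro μ hμ
  have hs := svec_pos A c x lam hμ hρ
  have hz := zvec_pos A c x lam hμ hρ
  have hden : ∀ i, 0 < svec A c x lam μ ρ i *
      (svec A c x lam μ ρ i + zvec A c x lam μ ρ i) :=
    fun i => mul_pos (hs i) (add_pos (hs i) (hz i))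
  have : Nonempty (Fin n) := ⟨⟨0, hn⟩⟩
  refine ⟨?_, ?_, ?_⟩
  · unfold phi
    have hlog := HasDerivAt.fun_sum (u := Finset.univ)
      fun i _ => (hasDerivAt_svec A c x lam hμ hρ i).log (hs i).ne'
    refine (hlog.fun_neg.const_mul ρ).congr_deriv ?_
    rw [mul_neg, neg_mul, Finset.mul_sum, Finset.mul_sum]
    congr 1
    refine Finset.sum_congr rfl fun i _ => ?_
    have h1 := (hs i).ne'
    have h2 := (add_pos (hs i) (hz i)).ne'
    field_simp
  · have hle : ∑ i, 1 / (svec A c x lam μ ρ i *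
        (svec A c x lam μ ρ i + zvec A c x lam μ ρ i)) ≤ ∑ _i : Fin n, 1 / (ρ * μ) := by
      refine Finset.sum_le_sum fun i _ => one_div_le_one_div_of_le (mul_pos hρ hμ) ?_
      rw [← svec_mul_zvec A c x lam hμ hρ i]
      exact mul_le_mul_of_nonneg_left (le_add_of_nonneg_left (hs i).le) (hs i).le
    rw [Finset.sum_const, Finset.card_univ, Fintype.card_fin, nsmul_eq_mul] at hle
    have heq : -(ρ * n) / μ = -(ρ ^ 2) * (n * (1 / (ρ * μ))) := by field_simp
    rw [heq]
    exact mul_le_mul_of_nonpos_left hle (neg_nonpos.mpr (sq_nonneg ρ))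
  · exact mul_neg_of_neg_of_pos (neg_neg_of_pos (pow_pos hρ 2))
      (Finset.sum_pos (fun i _ => one_div_pos.mpr (hden i)) Finset.univ_nonempty)
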